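/- In the semi-direct setting (see context) with p = 2 (so j = 1, 2, 3), suppose r(P_j) > 0 and r(R_j) > 0 for j = 2, 3, and that r(P_2) + r(P_3) ≥ l + 1 or r(R_2) + r(R_3) ≥ m + 1. Then s_1 + s_2 + s_3 ≥ 2lm + 2. -/

import Mathlib

open Polynomial BigOperators

noncomputable def rk {n : ℕ} (Y : Matrix (Fin n) (Fin n) ℂ) : ℕ :=
  ⨅ μ : ℂ, (Y - μ • (1 : Matrix (Fin n) (Fin n) ℂ)).rank

/-- The submodule of matrices commuting with `Y`. -/
noncomputable def centSub {n : ℕ} (Y : Matrix (Fin n) (Fin n) ℂ) : Submodule ℂ (Matrix (Fin n) (Fin n) ℂ) where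
  carrier := {Z | Y * Z = Z * Y}
  add_mem' := by
    intro a b ha hb
    simp only [Set.mem_setOf_eq] at *
    rw [Matrix.mul_add, Matrix.add_mul, ha, hb]
  zero_mem' := by simp
  smul_mem' := by
    intro c a ha
    simp only [Set.mem_setOf_eq] at *
    rw [Matrix.mul_smul, Matrix.smul_mul, ha]

/-- `d(Y) = n² - dim of centralizer of Y`, the dimension of the conjugacy class. -/
noncomputable def dd {n : ℕ} (Y : Matrix (Fin n) (Fin n) ℂ) : ℕ :=
  n ^ 2 - Module.finrank ℂ (centSub Y)

def SameClass {n : ℕ} (A B : Matrix (Fin n) (Fin n) ℂ) : Prop :=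
  ∃ S : Matrix (Fin n) (Fin n) ℂ, IsUnit S ∧ A = S * B * S⁻¹

def IrreducibleTuple {n q : ℕ} (A : Fin q → Matrix (Fin n) (Fin n) ℂ) : Prop :=
  ∀ W : Submodule ℂ (Fin n → ℂ), (∀ j, ∀ v ∈ W, (A j).mulVec v ∈ W) → W = ⊥ ∨ W = ⊤

def TrivialCentralizer {n q : ℕ} (A : Fin q → Matrix (Fin n) (Fin n) ℂ) : Prop :=
  ∀ Z : Matrix (Fin n) (Fin n) ℂ, (∀ j, Z * A j = A j * Z) →
    ∃ c : ℂ, Z = c • (1 : Matrix (Fin n) (Fin n) ℂ)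

def HasDistinctEigenvalues {n : ℕ} (Y : Matrix (Fin n) (Fin n) ℂ) : Prop :=
  ∃ μ : Fin n → ℂ, Function.Injective μ ∧ Y.charpoly = ∏ k, (Polynomial.X - Polynomial.C (μ k))

def IsDiagble {n : ℕ} (Y : Matrix (Fin n) (Fin n) ℂ) : Prop :=
  ∃ S : Matrix (Fin n) (Fin n) ℂ, IsUnit S ∧ ∃ d : Fin n → ℂ, Y = S * Matrix.diagonal d * S⁻¹

noncomputable def multOf {n : ℕ} (Y : Matrix (Fin n) (Fin n) ℂ) (μ : ℂ) : ℕ :=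
  Module.finrank ℂ (LinearMap.ker (Y - μ • (1 : Matrix (Fin n) (Fin n) ℂ)).mulVecLin)

/-- The Sylvester map `X ↦ P X - X R`. -/
noncomputable def sylv {l m : ℕ} (P : Matrix (Fin l) (Fin l) ℂ) (R : Matrix (Fin m) (Fin m) ℂ) :
    Matrix (Fin l) (Fin m) ℂ →ₗ[ℂ] Matrix (Fin l) (Fin m) ℂ where
  toFun Z := P * Z - Z * R
  map_add' Z W := by
    show P * (Z + W) - (Z + W) * R = (P * Z - Z * R) + (P * W - W * R)
    rw [Matrix.mul_add, Matrix.add_mul]; abel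
  map_smul' c Z := by
    show P * (c • Z) - (c • Z) * R = c • (P * Z - Z * R)
    rw [Matrix.mul_smul, Matrix.smul_mul, smul_sub]

noncomputable def sDim {l m : ℕ} (P : Matrix (Fin l) (Fin l) ℂ) (R : Matrix (Fin m) (Fin m) ℂ) : ℕ :=
  Module.finrank ℂ (LinearMap.range (sylv P R))

theorem sDim_ge {l m : ℕ} (P : Matrix (Fin l) (Fin l) ℂ) (S : Matrix (Fin m) (Fin m) ℂ)
    (hS : IsUnit S) (d : Fin m → ℂ) :
    ∑ k, (P - d k • (1 : Matrix (Fin l) (Fin l) ℂ)).rank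
      ≤ sDim P (S * Matrix.diagonal d * S⁻¹) := by
  have hdet : IsUnit S.det := (Matrix.isUnit_iff_isUnit_det S).1 hS
  let A : Fin m → Matrix (Fin l) (Fin l) ℂ := fun k => P - d k • 1
  let f : ((k : Fin m) → LinearMap.range (A k).mulVecLin) →ₗ[ℂ] Matrix (Fin l) (Fin m) ℂ :=
    { toFun := fun y => (Matrix.of fun i k => (y k : Fin l → ℂ) i) * S⁻¹
      map_add' := by
        intro a b
        rw [← Matrix.add_mul]
        rfl
      map_smul' := by
        intro c a
        rw [RingHom.id_apply, ← Matrix.smul_mul]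
        rfl }
  have hf : ∀ y, f y = (Matrix.of fun i k => (y k : Fin l → ℂ) i) * S⁻¹ := fun _ => rfl
  have hinj : Function.Injective f := by
    intro a b hab
    rw [hf, hf] at hab
    have h2 := congrArg (· * S) hab
    simp only [Matrix.nonsing_inv_mul_cancel_right _ _ hdet] at h2
    funext k
    apply Subtype.ext
    funext i
    exact congrFun (congrFun h2 i) k
  have hmem : ∀ y, f y ∈ LinearMap.range (sylv P (S * Matrix.diagonal d * S⁻¹)) := by
    intro y
    have hx : ∀ k, ∃ x : Fin l → ℂ, (A k).mulVec x = y k := fun k => (y k).2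
    choose x hx using hx
    let X : Matrix (Fin l) (Fin m) ℂ := Matrix.of fun i k => x k i
    refine ⟨X * S⁻¹, ?_⟩
    rw [hf]
    change P * (X * S⁻¹) - (X * S⁻¹) * (S * Matrix.diagonal d * S⁻¹) = _
    rw [← Matrix.mul_assoc P, Matrix.mul_assoc S, ← Matrix.mul_assoc _ S,
      Matrix.nonsing_inv_mul_cancel_right _ _ hdet, ← Matrix.mul_assoc, ← Matrix.sub_mul]
    congr 1
    ext i k
    rw [Matrix.sub_apply, Matrix.mul_diagonal, Matrix.of_apply, ← hx k]
    simp only [A, Matrix.sub_mulVec, Matrix.smul_mulVec, Matrix.one_mulVec, Pi.sub_apply,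
      Pi.smul_apply, smul_eq_mul]
    rw [mul_comm (d k)]
    rfl
  have h := LinearMap.finrank_le_finrank_of_injective
    (f := f.codRestrict _ hmem) (by
      intro a b hab
      exact hinj (congrArg Subtype.val hab))
  rw [Module.finrank_pi_fintype] at h
  exact h

theorem rk_le {n : ℕ} (Y : Matrix (Fin n) (Fin n) ℂ) (μ : ℂ) :
    rk Y ≤ (Y - μ • (1 : Matrix (Fin n) (Fin n) ℂ)).rank :=
  ciInf_le (OrderBot.bddBelow _) μ

theorem sDim_ge_rk {l m : ℕ} (P : Matrix (Fin l) (Fin l) ℂ) (R : Matrix (Fin m) (Fin m) ℂ)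
    (hR : IsDiagble R) : m * rk P ≤ sDim P R := by
  obtain ⟨S, hS, d, rfl⟩ := hR
  refine le_trans ?_ (sDim_ge P S hS d)
  have := Finset.sum_le_sum (s := Finset.univ) (fun (k : Fin m) _ => rk_le P (d k))
  simpa using this

theorem rk_transpose {n : ℕ} (Y : Matrix (Fin n) (Fin n) ℂ) : rk Y.transpose = rk Y := by
  unfold rk
  congr 1
  funext μ
  rw [← Matrix.rank_transpose]
  simp

theorem diag_transpose {n : ℕ} (Y : Matrix (Fin n) (Fin n) ℂ) (h : IsDiagble Y) :
    IsDiagble Y.transpose := by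
  obtain ⟨S, hS, d, rfl⟩ := h
  have hdet : IsUnit S.det := (Matrix.isUnit_iff_isUnit_det S).1 hS
  refine ⟨S⁻¹.transpose, ?_, d, ?_⟩
  · rw [Matrix.isUnit_iff_isUnit_det, Matrix.det_transpose]
    exact Matrix.isUnit_nonsing_inv_det S hdet
  · rw [Matrix.transpose_mul, Matrix.transpose_mul, Matrix.diagonal_transpose,
      ← Matrix.transpose_nonsing_inv, Matrix.nonsing_inv_nonsing_inv _ hdet, Matrix.mul_assoc]

theorem sDim_transpose {l m : ℕ} (P : Matrix (Fin l) (Fin l) ℂ) (R : Matrix (Fin m) (Fin m) ℂ) :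
    sDim R.transpose P.transpose ≤ sDim P R := by
  unfold sDim
  have hle : LinearMap.range (sylv R.transpose P.transpose) ≤
      (LinearMap.range (sylv P R)).map
        (Matrix.transposeLinearEquiv (Fin l) (Fin m) ℂ ℂ).toLinearMap := by
    rintro _ ⟨X, rfl⟩
    refine ⟨sylv P R (-X.transpose), ⟨_, rfl⟩, ?_⟩
    change (P * (-X.transpose) - (-X.transpose) * R).transpose = R.transpose * X - X * P.transpose
    simp [Matrix.transpose_mul]
    abel
  refine le_trans (Submodule.finrank_mono hle) ?_
  exact Submodule.finrank_map_le _ _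

theorem sDim_ge_rk_right {l m : ℕ} (P : Matrix (Fin l) (Fin l) ℂ) (R : Matrix (Fin m) (Fin m) ℂ)
    (hP : IsDiagble P) : l * rk R ≤ sDim P R := by
  rw [← rk_transpose R]
  exact (sDim_ge_rk _ _ (diag_transpose P hP)).trans (sDim_transpose P R)

theorem sDim_full {l m : ℕ} (P : Matrix (Fin l) (Fin l) ℂ) (R : Matrix (Fin m) (Fin m) ℂ)
    (hR : IsDiagble R)
    (hdisj : ∀ μ : ℂ, ¬((P - μ • (1 : Matrix (Fin l) (Fin l) ℂ)).det = 0 ∧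
        (R - μ • (1 : Matrix (Fin m) (Fin m) ℂ)).det = 0)) : m * l ≤ sDim P R := by
  obtain ⟨S, hS, d, rfl⟩ := hR
  have hdet : IsUnit S.det := (Matrix.isUnit_iff_isUnit_det S).1 hS
  refine le_trans ?_ (sDim_ge P S hS d)
  have h : ∀ k, (P - d k • (1 : Matrix (Fin l) (Fin l) ℂ)).rank = l := by
    intro k
    have h1 : (P - d k • (1 : Matrix (Fin l) (Fin l) ℂ)).det ≠ 0 := by
      intro h0
      apply hdisj (d k) ⟨h0, ?_⟩
      have e : S * Matrix.diagonal d * S⁻¹ - d k • (1 : Matrix (Fin m) (Fin m) ℂ)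
          = S * Matrix.diagonal (fun i => d i - d k) * S⁻¹ := by
        have : Matrix.diagonal (fun i => d i - d k)
            = Matrix.diagonal d - d k • (1 : Matrix (Fin m) (Fin m) ℂ) := by
          rw [Matrix.smul_one_eq_diagonal, Matrix.diagonal_sub]
        rw [this, Matrix.mul_sub, Matrix.sub_mul, Matrix.mul_smul, Matrix.smul_mul,
          Matrix.mul_one, Matrix.mul_nonsing_inv _ hdet]
      rw [e, Matrix.det_mul, Matrix.det_mul, Matrix.det_diagonal,
        Finset.prod_eq_zero (Finset.mem_univ k) (sub_self _)]
      simp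
    have h2 := Matrix.rank_of_isUnit _ ((Matrix.isUnit_iff_isUnit_det _).2 h1.isUnit)
    simpa using h2
  simp [h]

/-- In the semi-direct setting with `p = 2`, if `r(P_j) > 0` and `r(R_j) > 0` for
`j = 2, 3` and `r(P_2) + r(P_3) ≥ l + 1` or `r(R_2) + r(R_3) ≥ m + 1`, then
`s_1 + s_2 + s_3 ≥ 2lm + 2`. -/
theorem stmt18 (l m : ℕ) (hm : 2 ≤ m) (hlm : m ≤ l)
    (P : Fin 3 → Matrix (Fin l) (Fin l) ℂ)
    (R : Fin 3 → Matrix (Fin m) (Fin m) ℂ)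
    (hPdiag : ∀ j, IsDiagble (P j)) (hRdiag : ∀ j, IsDiagble (R j))
    (hPsum : ∑ j, P j = 0) (hRsum : ∑ j, R j = 0)
    (hPcent : TrivialCentralizer P) (hRcent : TrivialCentralizer R)
    (hPdist : HasDistinctEigenvalues (P 0)) (hRdist : HasDistinctEigenvalues (R 0))
    (hdisj : ∀ μ : ℂ, ¬((P 0 - μ • (1 : Matrix (Fin l) (Fin l) ℂ)).det = 0 ∧
        (R 0 - μ • (1 : Matrix (Fin m) (Fin m) ℂ)).det = 0))
    (hpos : ∀ j : Fin 3, j ≠ 0 → 0 < rk (P j) ∧ 0 < rk (R j))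
    (hbig : l + 1 ≤ rk (P 1) + rk (P 2) ∨ m + 1 ≤ rk (R 1) + rk (R 2)) :
    2 * l * m + 2 ≤ sDim (P 0) (R 0) + sDim (P 1) (R 1) + sDim (P 2) (R 2) := by
  have h0 := sDim_full (P 0) (R 0) (hRdiag 0) hdisj
  rcases hbig with h | h
  · have h1 := sDim_ge_rk (P 1) (R 1) (hRdiag 1)
    have h2 := sDim_ge_rk (P 2) (R 2) (hRdiag 2)
    nlinarith [Nat.mul_le_mul_left m h]
  · have h1 := sDim_ge_rk_right (P 1) (R 1) (hPdiag 1)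
    have h2 := sDim_ge_rk_right (P 2) (R 2) (hPdiag 2)
    nlinarith [Nat.mul_le_mul_left l h]
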